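/- arXiv:2109.01477 — 2 statements merged into one kernel-verified Lean document; each statement's English description precedes it below -/
import Mathlib

section
/- Let n ≥ 1 and let z₁,…,zₙ be complex numbers, none of which is a nonpositive integer (i.e. none lies in {0,−1,−2,…}). The series Λ*(s) = ∑_{m=0}^∞ (−1)^{m+1} ∏_{j=1}^n (m+z_j)^{−s} converges for Re(s) > 0, and there exists a function F, analytic on the half-plane {s ∈ ℂ : Re(s) > −1/n}, which agrees with Λ*(s) for Re(s) > 0. Moreover, for any such analytic continuation F, exp(F′(0)) = (π/2)^{n/2} / ∏_{j=1}^n Γ̃(z_j). (This is the zeta-regularized identity ∏_{m=0}^∞ {∏_{j=1}^n (m+z_j)}^{(−1)^m} = (√(π/2))^n / ∏_{j=1}^n Γ̃(z_j).) -/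
open Filter Finset Topology

/-- The modified Euler constant `γ̃₀ = 1/2 + (1/2)·∑_{j=1}^∞ (−1)^{j+1}/(j(j+1))`
(reindexed over `j : ℕ` starting at `0`). -/
noncomputable def gammaTilde0 : ℝ :=
  1 / 2 + (1 / 2) * ∑' j : ℕ, (-1 : ℝ) ^ j / ((j + 1) * (j + 2))

/-- The modified gamma function
`Γ̃(z) = z⁻¹ · exp(γ̃₀ z) · lim_{N→∞} ∏_{m=1}^N (exp(−z/m)(1+z/m))^{(−1)^{m+1}}`. -/
noncomputable def gammaTilde (z : ℂ) : ℂ :=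
  z⁻¹ * Complex.exp ((gammaTilde0 : ℂ) * z) *
    limUnder atTop (fun N : ℕ =>
      ∏ m ∈ Finset.Icc 1 N,
        (Complex.exp (-z / (m : ℂ)) * (1 + z / (m : ℂ))) ^ ((-1 : ℤ) ^ (m + 1)))

/-- The sum `∑ j, log (x + z j)`, as a function of a real variable `x`. -/
noncomputable def logSum {ι : Type*} [Fintype ι] (z : ι → ℂ) (x : ℝ) : ℂ :=
  ∑ j, Complex.log ((x : ℂ) + z j)

/-- The interpolation `x ↦ ∏ j, (x + z j) ^ (-s)` to a real variable `x`. -/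
noncomputable def prodPow {ι : Type*} [Fintype ι] (z : ι → ℂ) (s : ℂ) (x : ℝ) : ℂ :=
  Complex.exp (-s * logSum z x)

/-- The forward second difference `g x - 2 g (x + 1) + g (x + 2)`. -/
def secondDiff (g : ℝ → ℂ) (x : ℝ) : ℂ := g x - 2 * g (x + 1) + g (x + 2)

/-- The part of the `N`-th partial alternating sum of `g` that is left over when the alternating
series is transformed into that of the second differences. -/
noncomputable def eulerRemainder (g : ℝ → ℂ) (x : ℝ) : ℂ := g x / 2 + (g x - g (x + 1)) / 4

theorem prod_cpow_eq_prodPow {ι : Type*} [Fintype ι] {z : ι → ℂ} (s : ℂ) {x : ℝ}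
    (h : ∀ j, (x : ℂ) + z j ≠ 0) : ∏ j, ((x : ℂ) + z j) ^ (-s) = prodPow z s x := by
  rw [prodPow, logSum, Finset.mul_sum, Complex.exp_sum]
  exact Finset.prod_congr rfl fun j _ => by rw [Complex.cpow_def_of_ne_zero (h j), mul_comm]

theorem sum_alternating_eq (g : ℝ → ℂ) (N : ℕ) :
    ∑ m ∈ range N, (-1 : ℂ) ^ m * g m =
      eulerRemainder g 0 + 1 / 4 * ∑ m ∈ range N, (-1 : ℂ) ^ m * secondDiff g m
        - (-1) ^ N * eulerRemainder g N := by
  induction N with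
  | zero => simp
  | succ N ih =>
    rw [sum_range_succ, sum_range_succ, ih]
    simp only [eulerRemainder, secondDiff, Nat.cast_add, Nat.cast_one, pow_succ, add_assoc]
    norm_num
    ring

theorem norm_secondDiff_le {g g' g'' : ℝ → ℂ} {a C : ℝ}
    (hg : ∀ x, a ≤ x → HasDerivAt g (g' x) x) (hg' : ∀ x, a ≤ x → HasDerivAt g' (g'' x) x)
    (hC : ∀ x, a ≤ x → ‖g'' x‖ ≤ C) : ‖secondDiff g a‖ ≤ C := by
  have step : ∀ x, a ≤ x → ‖g' (x + 1) - g' x‖ ≤ C := fun x hx => by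
    have := (convex_Ici a).norm_image_sub_le_of_norm_hasDerivWithin_le
      (fun y hy => (hg' y hy).hasDerivWithinAt) (fun y hy => hC y hy)
      (show x ∈ Set.Ici a from hx) (show x + 1 ∈ Set.Ici a by simp only [Set.mem_Ici]; linarith)
    simpa using this
  have := (convex_Ici a).norm_image_sub_le_of_norm_hasDerivWithin_le
    (f := fun x => g (x + 1) - g x) (f' := fun x => g' (x + 1) - g' x)
    (fun y (hy : a ≤ y) => (((hg (y + 1) (by linarith)).comp_add_const y 1).sub
      (hg y hy)).hasDerivWithinAt) (fun y hy => step y hy)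
    Set.self_mem_Ici (show a + 1 ∈ Set.Ici a by simp)
  rw [show a + 1 + 1 = a + 2 by ring, add_sub_cancel_left, norm_one, mul_one] at this
  rwa [secondDiff, show g a - 2 * g (a + 1) + g (a + 2) =
    g (a + 2) - g (a + 1) - (g (a + 1) - g a) by ring]

section bounds

variable {ι : Type*} [Fintype ι] {z : ι → ℂ}

theorem half_le_norm_add {w : ℂ} {x : ℝ} (h : 2 * ‖w‖ ≤ x) : x / 2 ≤ ‖(x : ℂ) + w‖ := by
  have h1 := norm_sub_le_norm_add (x : ℂ) w
  have h2 : ‖(x : ℂ)‖ = x := by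
    rw [Complex.norm_real, Real.norm_of_nonneg ((by positivity : 0 ≤ 2 * ‖w‖).trans h)]
  linarith

theorem add_mem_slitPlane {w : ℂ} {x : ℝ} (hx : 0 < x) (h : 2 * ‖w‖ ≤ x) :
    (x : ℂ) + w ∈ Complex.slitPlane := by
  left
  have := (abs_le.1 (Complex.abs_re_le_norm w)).1
  simp only [Complex.add_re, Complex.ofReal_re]
  linarith [norm_nonneg w]

theorem hasDerivAt_logSum {x : ℝ} (hx : 0 < x) (h : ∀ j, 2 * ‖z j‖ ≤ x) :
    HasDerivAt (logSum z) (∑ j, ((x : ℂ) + z j)⁻¹) x := by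
  unfold logSum
  refine HasDerivAt.fun_sum fun j _ => ?_
  simpa using (((hasDerivAt_id x).ofReal_comp.add_const (z j)).clog_real
    (add_mem_slitPlane hx (h j)))

theorem hasDerivAt_sum_inv {x : ℝ} (hx : 0 < x) (h : ∀ j, 2 * ‖z j‖ ≤ x) :
    HasDerivAt (fun x : ℝ => ∑ j, ((x : ℂ) + z j)⁻¹) (-∑ j, ((x : ℂ) + z j)⁻¹ ^ 2) x := by
  rw [← Finset.sum_neg_distrib]
  refine HasDerivAt.fun_sum fun j _ => ?_
  have := ((hasDerivAt_id x).ofReal_comp.add_const (z j)).fun_inv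
    (Complex.slitPlane_ne_zero (add_mem_slitPlane hx (h j)))
  simpa [div_eq_mul_inv] using this

theorem hasDerivAt_prodPow (s : ℂ) {x : ℝ} (hx : 0 < x) (h : ∀ j, 2 * ‖z j‖ ≤ x) :
    HasDerivAt (prodPow z s) (prodPow z s x * (-s * ∑ j, ((x : ℂ) + z j)⁻¹)) x :=
  ((hasDerivAt_logSum hx h).const_mul (-s)).cexp

theorem norm_prodPow_le (s : ℂ) {x : ℝ} (hx : 0 < x) (h : ∀ j, 2 * ‖z j‖ ≤ x) :
    ‖prodPow z s x‖ ≤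
      Real.exp (5 * Fintype.card ι * ‖s‖) * x ^ (-(Fintype.card ι * s.re)) := by
  have hlog : ∀ j, ‖Complex.log ((x : ℂ) + z j) - Real.log x‖ ≤ 5 := fun j => by
    have hlow := half_le_norm_add (h j)
    have hup : ‖(x : ℂ) + z j‖ ≤ 2 * x := by
      refine (norm_add_le _ _).trans ?_
      rw [Complex.norm_real, Real.norm_of_nonneg hx.le]
      linarith [h j, norm_nonneg (z j)]
    have h1 := Real.log_le_log (by positivity) hlow
    have h2 := Real.log_le_log (by linarith [half_pos hx]) hup
    rw [Real.log_div hx.ne' two_ne_zero] at h1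
    rw [Real.log_mul two_ne_zero hx.ne'] at h2
    have h3 := Real.log_two_lt_d9
    refine (Complex.norm_le_abs_re_add_abs_im _).trans ?_
    simp only [Complex.sub_re, Complex.sub_im, Complex.log_re, Complex.log_im, Complex.ofReal_re,
      Complex.ofReal_im, sub_zero]
    have h4 := Complex.abs_arg_le_pi ((x : ℂ) + z j)
    have h5 : |Real.log ‖(x : ℂ) + z j‖ - Real.log x| ≤ 0.7 :=
      abs_le.2 ⟨by linarith, by linarith⟩
    linarith [Real.pi_lt_d2]
  have hsum : ‖logSum z x - Fintype.card ι * Real.log x‖ ≤ 5 * Fintype.card ι := by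
    have : logSum z x - Fintype.card ι * Real.log x =
        ∑ j, (Complex.log ((x : ℂ) + z j) - Real.log x) := by
      simp [logSum]
    rw [this]
    refine (norm_sum_le_of_le _ fun j _ => hlog j).trans ?_
    simp [mul_comm]
  rw [prodPow, Complex.norm_exp, Real.rpow_def_of_pos hx, ← Real.exp_add, Real.exp_le_exp]
  have hre : (-s * logSum z x).re = (-s * (logSum z x - Fintype.card ι * Real.log x)).re
      + Real.log x * -(Fintype.card ι * s.re) := by
    simp only [Complex.mul_re, Complex.sub_re, Complex.sub_im, Complex.neg_re, Complex.neg_im,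
      Complex.natCast_re, Complex.natCast_im, Complex.ofReal_re, Complex.ofReal_im, Complex.mul_im]
    ring
  rw [hre, add_le_add_iff_right]
  refine (Complex.re_le_norm _).trans ?_
  rw [norm_mul, norm_neg, mul_comm]
  exact mul_le_mul_of_nonneg_right hsum (norm_nonneg _)

theorem norm_secondDiff_prodPow_le {s : ℂ} {x σ R : ℝ} (hx : 1 ≤ x) (h : ∀ j, 2 * ‖z j‖ ≤ x)
    (hσ : σ ≤ s.re) (hR : ‖s‖ ≤ R) (hp : 0 ≤ Fintype.card ι * σ + 2) :
    ‖secondDiff (prodPow z s) x‖ ≤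
      Real.exp (5 * Fintype.card ι * R) * ((R * (2 * Fintype.card ι)) ^ 2 + R * (4 * Fintype.card ι))
        * x ^ (-(Fintype.card ι * σ + 2)) := by
  have hx0 : 0 < x := by linarith
  have hR0 : 0 ≤ R := (norm_nonneg s).trans hR
  have hd : ∀ y, x ≤ y → HasDerivAt (prodPow z s)
      (prodPow z s y * (-s * ∑ j, ((y : ℂ) + z j)⁻¹)) y := fun y hy =>
    hasDerivAt_prodPow s (hx0.trans_le hy) fun j => (h j).trans hy
  refine norm_secondDiff_le hd (fun y hy => (hd y hy).mul ((hasDerivAt_sum_inv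
    (hx0.trans_le hy) fun j => (h j).trans hy).const_mul (-s))) fun y hy => ?_
  have hy0 : 0 < y := hx0.trans_le hy
  have hinv : ∀ j, ‖((y : ℂ) + z j)⁻¹‖ ≤ 2 / y := fun j => by
    rw [norm_inv]
    refine (inv_anti₀ (by positivity) (half_le_norm_add ((h j).trans hy))).trans_eq (inv_div _ _)
  have h1 : ‖∑ j, ((y : ℂ) + z j)⁻¹‖ ≤ 2 * Fintype.card ι / y := by
    refine (norm_sum_le_of_le _ fun j _ => hinv j).trans_eq ?_
    simp; ring
  have h2 : ‖∑ j, ((y : ℂ) + z j)⁻¹ ^ 2‖ ≤ 4 * Fintype.card ι / y ^ 2 := by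
    refine (norm_sum_le_of_le (f := fun j => ((y : ℂ) + z j)⁻¹ ^ 2) (n := fun _ => (2 / y) ^ 2) _
      fun j _ => ?_).trans_eq ?_
    · rw [norm_pow]; gcongr; exact hinv j
    · simp; ring
  have h3 : ‖prodPow z s y‖ ≤
      Real.exp (5 * Fintype.card ι * R) * y ^ (-(Fintype.card ι * σ)) := by
    refine (norm_prodPow_le s hy0 fun j => (h j).trans hy).trans ?_
    gcongr
    linarith
  have key : prodPow z s y * (-s * ∑ j, ((y : ℂ) + z j)⁻¹) * (-s * ∑ j, ((y : ℂ) + z j)⁻¹) +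
      prodPow z s y * (-s * -∑ j, ((y : ℂ) + z j)⁻¹ ^ 2) =
      prodPow z s y * ((s * ∑ j, ((y : ℂ) + z j)⁻¹) ^ 2 + s * ∑ j, ((y : ℂ) + z j)⁻¹ ^ 2) := by
    ring
  rw [key, norm_mul]
  have h4 : ‖(s * ∑ j, ((y : ℂ) + z j)⁻¹) ^ 2 + s * ∑ j, ((y : ℂ) + z j)⁻¹ ^ 2‖ ≤
      (R * (2 * Fintype.card ι / y)) ^ 2 + R * (4 * Fintype.card ι / y ^ 2) := by
    refine (norm_add_le _ _).trans ?_
    rw [norm_pow, norm_mul, norm_mul]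
    gcongr
  refine (mul_le_mul h3 h4 (norm_nonneg _) (by positivity)).trans ?_
  have h5 : y ^ (-(Fintype.card ι * σ + 2)) ≤ x ^ (-(Fintype.card ι * σ + 2)) :=
    Real.rpow_le_rpow_of_nonpos hx0 hy (by linarith)
  refine le_trans (le_of_eq ?_) (mul_le_mul_of_nonneg_left h5 (by positivity))
  rw [neg_add, Real.rpow_add hy0, Real.rpow_neg hy0.le 2, Real.rpow_two]
  field_simp

end bounds

section continuation

variable {ι : Type*} [Fintype ι] (z : ι → ℂ)

theorem hasDerivAt_prodPow_param (s : ℂ) (x : ℝ) :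
    HasDerivAt (fun s => prodPow z s x) (prodPow z s x * -logSum z x) s := by
  simpa [prodPow] using ((hasDerivAt_id s).neg.mul_const (logSum z x)).cexp

theorem differentiable_secondDiff_prodPow (m : ℕ) :
    Differentiable ℂ fun s => (-1 : ℂ) ^ m * secondDiff (prodPow z s) m := by
  have h : ∀ x : ℝ, Differentiable ℂ fun s => prodPow z s x := fun x s =>
    (hasDerivAt_prodPow_param z s x).differentiableAt
  exact (((h _).sub ((h _).const_mul 2)).add (h _)).const_mul _

theorem exists_forall_two_mul_norm_le : ∃ M : ℕ, 1 ≤ M ∧ ∀ j, 2 * ‖z j‖ ≤ M := by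
  obtain ⟨M, hM⟩ := exists_nat_ge (1 + ∑ j, 2 * ‖z j‖)
  have h0 : ∀ j, 2 * ‖z j‖ ≤ ∑ j, 2 * ‖z j‖ := fun j =>
    Finset.single_le_sum (f := fun j => 2 * ‖z j‖) (fun i _ => by positivity) (Finset.mem_univ j)
  have h1 : 0 ≤ ∑ j, 2 * ‖z j‖ := Finset.sum_nonneg fun i _ => by positivity
  exact ⟨M, by exact_mod_cast (show (1 : ℝ) ≤ M by linarith), fun j => by linarith [h0 j]⟩

theorem exists_summable_bound [Nonempty ι] {s₀ : ℂ}
    (hs : -(1 / (Fintype.card ι : ℝ)) < s₀.re) :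
    ∃ r > 0, ∃ u : ℕ → ℝ, Summable u ∧ ∀ (m : ℕ), ∀ s ∈ Metric.ball s₀ r,
      ‖(-1 : ℂ) ^ m * secondDiff (prodPow z s) m‖ ≤ u m := by
  obtain ⟨M, hM1, hM⟩ := exists_forall_two_mul_norm_le z
  have hn : (0 : ℝ) < Fintype.card ι := by exact_mod_cast Fintype.card_pos
  set r : ℝ := (s₀.re + 1 / (Fintype.card ι : ℝ)) / 2 with hr
  have hr0 : 0 < r := by linarith
  set σ : ℝ := s₀.re - r with hσ
  have hσn : -1 < Fintype.card ι * σ := by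
    have : -(1 / (Fintype.card ι : ℝ)) < σ := by linarith
    have := mul_lt_mul_of_pos_left this hn
    rwa [mul_neg, mul_one_div_cancel hn.ne'] at this
  choose C hC using fun m : ℕ => (isCompact_closedBall s₀ r).exists_bound_of_continuousOn
    (differentiable_secondDiff_prodPow z m).continuous.continuousOn
  set K : ℝ := Real.exp (5 * Fintype.card ι * (‖s₀‖ + r)) *
    (((‖s₀‖ + r) * (2 * Fintype.card ι)) ^ 2 + (‖s₀‖ + r) * (4 * Fintype.card ι))
  refine ⟨r, hr0, fun m => if m < M then C m else K * (m : ℝ) ^ (-(Fintype.card ι * σ + 2)), ?_,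
    fun m s hs' => ?_⟩
  · refine summable_of_isBigO_nat
      ((Real.summable_nat_rpow (p := -(Fintype.card ι * σ + 2)).2 (by linarith)).mul_left K)
      (EventuallyEq.isBigO ?_)
    filter_upwards [eventually_ge_atTop M] with m hm
    rw [if_neg (by omega)]
  · dsimp only
    split_ifs with hm
    · exact hC m s (Metric.ball_subset_closedBall hs')
    · have hmM : (M : ℝ) ≤ m := by exact_mod_cast not_lt.1 hm
      rw [norm_mul, norm_pow, norm_neg, norm_one, one_pow, one_mul]
      rw [mem_ball_iff_norm] at hs'
      refine norm_secondDiff_prodPow_le ?_ (fun j => (hM j).trans hmM) ?_ ?_ (by linarith)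
      · exact le_trans (by exact_mod_cast hM1) hmM
      · have := (abs_le.1 (Complex.abs_re_le_norm (s - s₀))).1
        rw [Complex.sub_re] at this
        linarith
      · linarith [norm_le_norm_add_norm_sub' s s₀]

/-- The analytic continuation of `s ↦ ∑ m, (-1) ^ (m + 1) * ∏ j, (m + z j) ^ (-s)`. -/
noncomputable def altZeta (s : ℂ) : ℂ :=
  -(eulerRemainder (prodPow z s) 0 +
    1 / 4 * ∑' m : ℕ, (-1 : ℂ) ^ m * secondDiff (prodPow z s) m)

theorem hasDerivAt_eulerRemainder_prodPow (x : ℝ) :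
    HasDerivAt (fun s => eulerRemainder (prodPow z s) x) (-eulerRemainder (logSum z) x) 0 := by
  have h : ∀ x, HasDerivAt (fun s => prodPow z s x) (-logSum z x) 0 := fun x => by
    simpa [prodPow] using hasDerivAt_prodPow_param z 0 x
  convert! ((h x).div_const 2).add (((h x).sub (h (x + 1))).div_const 4) using 1
  rw [eulerRemainder]; ring

theorem hasDerivAt_secondDiff_prodPow (m : ℕ) :
    HasDerivAt (fun s => (-1 : ℂ) ^ m * secondDiff (prodPow z s) m)
      (-((-1 : ℂ) ^ m * secondDiff (logSum z) m)) 0 := by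
  have h : ∀ x, HasDerivAt (fun s => prodPow z s x) (-logSum z x) 0 := fun x => by
    simpa [prodPow] using hasDerivAt_prodPow_param z 0 x
  convert! (((h m).sub ((h (m + 1)).const_mul 2)).add (h (m + 2))).const_mul ((-1 : ℂ) ^ m) using 1
  rw [secondDiff]; ring

theorem tendsto_log_add_sub_log (w : ℂ) :
    Tendsto (fun N : ℕ => Complex.log ((N : ℂ) + w) - Real.log N) atTop (𝓝 0) := by
  have h : Tendsto (fun N : ℕ => 1 + w / (N : ℂ)) atTop (𝓝 1) := by
    simpa using (tendsto_const_div_atTop_nhds_zero_nat w).const_add 1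
  have h2 := h.clog (by simp)
  rw [Complex.log_one] at h2
  refine h2.congr' ?_
  filter_upwards [h.eventually_ne one_ne_zero, eventually_gt_atTop 0] with N hN hN0
  have hN0' : (0 : ℝ) < N := by exact_mod_cast hN0
  have hN1 : (N : ℂ) ≠ 0 := by exact_mod_cast hN0.ne'
  have : (N : ℂ) + w = (N : ℝ) * (1 + w / (N : ℂ)) := by
    push_cast; field_simp
  rw [this, Complex.log_ofReal_mul hN0' hN]
  ring

variable [Nonempty ι]

theorem differentiableAt_tsum_secondDiff {s : ℂ} (hs : -(1 / (Fintype.card ι : ℝ)) < s.re) :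
    DifferentiableAt ℂ (fun s => ∑' m : ℕ, (-1 : ℂ) ^ m * secondDiff (prodPow z s) m) s := by
  obtain ⟨r, hr, u, hu, hb⟩ := exists_summable_bound z hs
  exact (Complex.differentiableOn_tsum_of_summable_norm hu
    (fun m => (differentiable_secondDiff_prodPow z m).differentiableOn) Metric.isOpen_ball
    hb).differentiableAt (Metric.ball_mem_nhds s hr)

theorem analyticOnNhd_altZeta :
    AnalyticOnNhd ℂ (altZeta z) {s : ℂ | -(1 / (Fintype.card ι : ℝ)) < s.re} := by
  refine DifferentiableOn.analyticOnNhd (fun s hs => ?_)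
    (isOpen_lt continuous_const Complex.continuous_re)
  have h : ∀ x : ℝ, DifferentiableAt ℂ (fun s => prodPow z s x) s := fun x =>
    (hasDerivAt_prodPow_param z s x).differentiableAt
  have h' : DifferentiableAt ℂ (fun s => eulerRemainder (prodPow z s) 0) s :=
    ((h _).div_const 2).add (((h _).sub (h _)).div_const 4)
  exact (h'.add ((differentiableAt_tsum_secondDiff z hs).const_mul _)).neg.differentiableWithinAt

theorem tendsto_prodPow_atTop {s : ℂ} (hs : 0 < s.re) :
    Tendsto (fun N : ℕ => prodPow z s N) atTop (𝓝 0) := by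
  obtain ⟨M, hM1, hM⟩ := exists_forall_two_mul_norm_le z
  have hn : (0 : ℝ) < Fintype.card ι := by exact_mod_cast Fintype.card_pos
  have := (((tendsto_rpow_neg_atTop (mul_pos hn hs)).comp
    tendsto_natCast_atTop_atTop).const_mul (Real.exp (5 * Fintype.card ι * ‖s‖)))
  rw [mul_zero] at this
  refine squeeze_zero_norm' ?_ this
  filter_upwards [eventually_ge_atTop M] with N hN
  have hN' : (M : ℝ) ≤ N := by exact_mod_cast hN
  exact norm_prodPow_le s (by exact_mod_cast hM1.trans hN) fun j => (hM j).trans hN'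

theorem tendsto_sum_altZeta {s : ℂ} (hs : 0 < s.re) :
    Tendsto (fun N : ℕ => ∑ m ∈ range N, (-1 : ℂ) ^ (m + 1) * prodPow z s m) atTop
      (𝓝 (altZeta z s)) := by
  have hs' : -(1 / (Fintype.card ι : ℝ)) < s.re :=
    lt_of_le_of_lt (neg_nonpos.2 (by positivity)) hs
  obtain ⟨r, hr, u, hu, hb⟩ := exists_summable_bound z hs'
  have hsum : Summable fun m : ℕ => (-1 : ℂ) ^ m * secondDiff (prodPow z s) m :=
    hu.of_norm_bounded fun m => hb m s (Metric.mem_ball_self hr)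
  have h0 := tendsto_prodPow_atTop z hs
  have h1 := h0.comp (tendsto_add_atTop_nat 1)
  have hrem : Tendsto (fun N : ℕ => (-1 : ℂ) ^ N * eulerRemainder (prodPow z s) N) atTop (𝓝 0) := by
    have := (h0.div_const 2).add ((h0.sub h1).div_const 4)
    simp only [zero_div, sub_zero, add_zero] at this
    rw [tendsto_zero_iff_norm_tendsto_zero] at this ⊢
    simpa [eulerRemainder] using this
  have := ((tendsto_const_nhds (x := eulerRemainder (prodPow z s) 0)).add
    (hsum.hasSum.tendsto_sum_nat.const_mul (1 / 4))).sub hrem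
  rw [sub_zero] at this
  refine this.neg.congr fun N => ?_
  rw [← sum_alternating_eq, ← Finset.sum_neg_distrib]
  exact Finset.sum_congr rfl fun m _ => by ring

theorem tendsto_deriv_altZeta_aux :
    Tendsto (fun N : ℕ => ∑ m ∈ range N, (-1 : ℂ) ^ m * logSum z m +
      (-1) ^ N * eulerRemainder (logSum z) N) atTop (𝓝 (deriv (altZeta z) 0)) := by
  have hs : -(1 / (Fintype.card ι : ℝ)) < (0 : ℂ).re := by
    simpa using (Fintype.card_pos : 0 < Fintype.card ι)
  obtain ⟨r, hr, u, hu, hb⟩ := exists_summable_bound z hs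
  have h := (Complex.hasSum_deriv_of_summable_norm hu
    (fun m => (differentiable_secondDiff_prodPow z m).differentiableOn) Metric.isOpen_ball
    hb (Metric.mem_ball_self hr)).tendsto_sum_nat
  simp only [(hasDerivAt_secondDiff_prodPow z _).deriv] at h
  have hd : deriv (altZeta z) 0 = -(-eulerRemainder (logSum z) 0 + 1 / 4 *
      deriv (fun s => ∑' m : ℕ, (-1 : ℂ) ^ m * secondDiff (prodPow z s) m) 0) :=
    ((hasDerivAt_eulerRemainder_prodPow z 0).add
      ((differentiableAt_tsum_secondDiff z hs).hasDerivAt.const_mul (1 / 4))).neg.deriv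
  rw [hd]
  refine ((h.const_mul (1 / 4)).const_add _).neg.congr fun N => ?_
  rw [sum_alternating_eq, Finset.sum_neg_distrib]
  ring

theorem tendsto_deriv_altZeta :
    Tendsto (fun N : ℕ => ∑ m ∈ range N, (-1 : ℂ) ^ m * logSum z m +
      (-1) ^ N * (Fintype.card ι / 2 * Real.log N)) atTop (𝓝 (deriv (altZeta z) 0)) := by
  have h : Tendsto (fun N : ℕ => ∑ j, (3 / 4 * (Complex.log ((N : ℂ) + z j) - Real.log N) -
      1 / 4 * (Complex.log ((N : ℂ) + (1 + z j)) - Real.log N))) atTop (𝓝 0) := by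
    rw [show (0 : ℂ) = ∑ j : ι, (3 / 4 * 0 - 1 / 4 * 0) by simp]
    exact tendsto_finsetSum _ fun j _ => ((tendsto_log_add_sub_log _).const_mul _).sub
      ((tendsto_log_add_sub_log _).const_mul _)
  have h' : Tendsto (fun N : ℕ => (-1 : ℂ) ^ N * (eulerRemainder (logSum z) N -
      Fintype.card ι / 2 * Real.log N)) atTop (𝓝 0) := by
    rw [tendsto_zero_iff_norm_tendsto_zero] at h ⊢
    refine h.congr fun N => ?_
    rw [norm_mul, norm_pow, norm_neg, norm_one, one_pow, one_mul]
    congr 1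
    rw [Finset.sum_sub_distrib, ← Finset.mul_sum, ← Finset.mul_sum, Finset.sum_sub_distrib,
      Finset.sum_sub_distrib]
    simp only [eulerRemainder, logSum, Finset.sum_const, Finset.card_univ, nsmul_eq_mul,
      Complex.ofReal_add, Complex.ofReal_natCast, Complex.ofReal_one, add_assoc]
    ring
  have := (tendsto_deriv_altZeta_aux z).sub h'
  rw [sub_zero] at this
  exact this.congr fun N => by ring

end continuation

section gammaTilde

/-- The sum `∑ m < N, (-1) ^ m * log (m + w)`. -/
noncomputable def altLog (w : ℂ) (N : ℕ) : ℂ :=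
  ∑ m ∈ range N, (-1 : ℂ) ^ m * Complex.log ((m : ℂ) + w)

theorem exists_tendsto_altLog (w : ℂ) :
    ∃ L, Tendsto (fun N : ℕ => altLog w N + (-1) ^ N * (Real.log N / 2)) atTop (𝓝 L) := by
  refine ⟨_, (tendsto_deriv_altZeta fun _ : Unit => w).congr fun N => ?_⟩
  simp [altLog, logSum]
  ring

theorem exp_two_mul_altLog_one (K : ℕ) :
    (2 * K + 1) * Real.Wallis.W K * Complex.exp (2 * altLog 1 (2 * K)) = (1 : ℂ) := by
  induction K with
  | zero => simp [altLog, Real.Wallis.W]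
  | succ K ih =>
    have h1 : (2 * K + 1 : ℂ) ≠ 0 := by exact_mod_cast Nat.succ_ne_zero (2 * K)
    have h2 : (2 * K + 2 : ℂ) ≠ 0 := by exact_mod_cast Nat.succ_ne_zero (2 * K + 1)
    have h3 : (2 * K + 3 : ℂ) ≠ 0 := by exact_mod_cast Nat.succ_ne_zero (2 * K + 2)
    have hstep : altLog 1 (2 * (K + 1)) =
        altLog 1 (2 * K) + (Complex.log (2 * K + 1) - Complex.log (2 * K + 2)) := by
      rw [altLog, show 2 * (K + 1) = 2 * K + 1 + 1 by ring, sum_range_succ, sum_range_succ, altLog]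
      simp only [pow_succ, pow_mul]
      push_cast
      rw [show (2 * K + 1 + 1 : ℂ) = 2 * K + 2 by ring]
      norm_num
      ring
    have hexp : Complex.exp (2 * (Complex.log (2 * K + 1) - Complex.log (2 * K + 2))) =
        ((2 * K + 1) / (2 * K + 2)) ^ 2 := by
      rw [← Complex.exp_log h1, ← Complex.exp_log h2, ← Complex.exp_sub, ← Complex.exp_nat_mul,
        Complex.exp_log h1, Complex.exp_log h2]
      norm_num
    rw [hstep, mul_add, Complex.exp_add, hexp, Real.Wallis.W_succ]
    refine Eq.trans ?_ ih
    push_cast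
    field_simp
    ring

theorem exp_neg_lim_altLog_one {L : ℂ}
    (hL : Tendsto (fun N : ℕ => altLog 1 N + (-1) ^ N * (Real.log N / 2)) atTop (𝓝 L)) :
    Complex.exp (-L) = Real.sqrt (Real.pi / 2) := by
  have him : ∀ N : ℕ, (altLog 1 N + (-1) ^ N * (Real.log N / 2)).im = 0 := fun N => by
    have : altLog 1 N + (-1) ^ N * (Real.log N / 2) =
        ((∑ m ∈ range N, (-1 : ℝ) ^ m * Real.log (m + 1) + (-1) ^ N * (Real.log N / 2) : ℝ) : ℂ) := by
      push_cast
      rw [altLog]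
      congr 1
      refine Finset.sum_congr rfl fun m _ => ?_
      rw [Complex.ofReal_log (by positivity)]
      push_cast; rfl
    rw [this, Complex.ofReal_im]
  have hLim : L.im = 0 := tendsto_nhds_unique
    ((Complex.continuous_im.tendsto L).comp hL)
    (tendsto_const_nhds.congr fun N => (him N).symm)
  have hLre : L = (L.re : ℂ) := Complex.ext (by simp) (by simp [hLim])
  have hsub : Tendsto (fun K : ℕ => 2 * K) atTop atTop :=
    tendsto_atTop_mono (fun K => by simp only [id]; omega) tendsto_id
  have h1 := ((hL.comp hsub).const_mul (-2)).cexp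
  have hinv : Tendsto (fun K : ℕ => 1 + (1 / 2 : ℂ) / (K : ℂ)) atTop (𝓝 1) := by
    have := (tendsto_const_div_atTop_nhds_zero_nat (1 / 2 : ℂ)).const_add 1
    rwa [add_zero] at this
  have hW : Tendsto (fun K : ℕ => (Real.Wallis.W K : ℂ)) atTop (𝓝 ((Real.pi / 2 : ℝ) : ℂ)) :=
    Filter.tendsto_ofReal_iff.2 Real.Wallis.tendsto_W_nhds_pi_div_two
  have h2 := hinv.mul hW
  rw [one_mul] at h2
  have h3 : Complex.exp (-2 * L) = ((Real.pi / 2 : ℝ) : ℂ) := by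
    refine tendsto_nhds_unique h1 (h2.congr' ?_)
    filter_upwards [eventually_gt_atTop 0] with K hK
    have hK0 : (K : ℂ) ≠ 0 := by exact_mod_cast hK.ne'
    have hlog : Complex.exp ((Real.log (2 * K : ℕ) : ℝ) : ℂ) = 2 * K := by
      rw [← Complex.ofReal_exp, Real.exp_log (by positivity)]
      push_cast; rfl
    have hsplit : -2 * (altLog 1 (2 * K) + (-1) ^ (2 * K) * (Real.log (2 * K : ℕ) / 2)) =
        -(2 * altLog 1 (2 * K)) - (Real.log (2 * K : ℕ) : ℂ) := by
      rw [pow_mul]; norm_num; ring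
    simp only [Function.comp_apply]
    rw [hsplit, Complex.exp_sub, hlog, Complex.exp_neg,
      ← eq_inv_of_mul_eq_one_left (exp_two_mul_altLog_one K)]
    field_simp
  rw [hLre] at h3 ⊢
  have h4 : Real.exp (-L.re) ^ 2 = Real.pi / 2 := by
    rw [← Real.exp_nat_mul]
    rw [← Complex.ofReal_inj, ← h3]
    push_cast; congr 1; ring
  rw [← h4, Real.sqrt_sq (Real.exp_pos _).le]
  push_cast; rfl

theorem tendsto_altHarmonic :
    Tendsto (fun N : ℕ => ∑ m ∈ Finset.Icc 1 N, (-1 : ℝ) ^ (m + 1) / m) atTop (𝓝 gammaTilde0) := by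
  have hsum : Summable fun j : ℕ => (-1 : ℝ) ^ j / ((j + 1) * (j + 2)) := by
    refine Summable.of_norm_bounded
      ((summable_nat_add_iff 1).2 (Real.summable_one_div_nat_pow.2 one_lt_two)) fun j => ?_
    rw [norm_div, norm_pow, norm_neg, norm_one, one_pow, Real.norm_of_nonneg (by positivity)]
    push_cast
    gcongr
    nlinarith [(Nat.cast_nonneg j : (0 : ℝ) ≤ j)]
  have hpart : ∀ N : ℕ, ∑ m ∈ Finset.Icc 1 N, (-1 : ℝ) ^ (m + 1) / m =
      1 / 2 + 1 / 2 * ∑ j ∈ range N, (-1 : ℝ) ^ j / ((j + 1) * (j + 2))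
        - (-1) ^ N * (1 / 2 * (1 / ((N : ℝ) + 1))) := fun N => by
    induction N with
    | zero => norm_num
    | succ N ih =>
      rw [Finset.sum_Icc_succ_top (by omega), ih, sum_range_succ]
      push_cast
      have h1 : (N : ℝ) + 1 ≠ 0 := by positivity
      have h2 : (N : ℝ) + 2 ≠ 0 := by positivity
      rw [show (N : ℝ) + 1 + 1 = N + 2 by ring, pow_succ, pow_succ]
      field_simp
      ring
  have h0 : Tendsto (fun N : ℕ => (-1 : ℝ) ^ N * (1 / 2 * (1 / ((N : ℝ) + 1)))) atTop (𝓝 0) := by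
    have := (tendsto_one_div_add_atTop_nhds_zero_nat (𝕜 := ℝ)).const_mul (1 / 2)
    rw [mul_zero, tendsto_zero_iff_norm_tendsto_zero] at this
    rw [tendsto_zero_iff_norm_tendsto_zero]
    simpa using this
  have := ((hsum.hasSum.tendsto_sum_nat.const_mul (1 / 2)).const_add (1 / 2)).sub h0
  rw [sub_zero] at this
  exact this.congr fun N => (hpart N).symm

theorem prod_mul_exp_altLog {w : ℂ} (hw : ∀ k : ℕ, w ≠ -(k : ℂ)) (N : ℕ) :
    (∏ m ∈ Finset.Icc 1 N,
        (Complex.exp (-w / (m : ℂ)) * (1 + w / (m : ℂ))) ^ ((-1 : ℤ) ^ (m + 1))) *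
      Complex.exp (altLog w (N + 1) + altLog 1 N) =
      w * Complex.exp (-w * ((∑ m ∈ Finset.Icc 1 N, (-1 : ℝ) ^ (m + 1) / m : ℝ) : ℂ)) := by
  induction N with
  | zero =>
    have : w ≠ 0 := by simpa using hw 0
    simp [altLog, Complex.exp_log this]
  | succ N ih =>
    have h1 : (N + 1 : ℂ) ≠ 0 := by exact_mod_cast Nat.succ_ne_zero N
    have h2 : (N + 1 : ℂ) + w ≠ 0 := fun h => hw (N + 1) (by
      push_cast; linear_combination h)
    have h3 : 1 + w / ((N : ℂ) + 1) = ((N + 1 : ℂ) + w) / (N + 1) := by field_simp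
    have e1 : altLog w (N + 1 + 1) = altLog w (N + 1) -
        (-1) ^ N * Complex.log ((N + 1 : ℂ) + w) := by
      rw [altLog, sum_range_succ, altLog, pow_succ]; push_cast; ring
    have e2 : altLog 1 (N + 1) = altLog 1 N + (-1) ^ N * Complex.log (N + 1 : ℂ) := by
      rw [altLog, sum_range_succ, altLog]
    have e3 : ∀ a b c d : ℂ, a - b + (c + d) = (a + c) + (d - b) := fun a b c d => by ring
    rw [Finset.prod_Icc_succ_top (by omega), Finset.sum_Icc_succ_top (by omega), e1, e2, e3,
      Complex.exp_add, mul_mul_mul_comm, ih, Complex.ofReal_add, mul_add (-w), Complex.exp_add,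
      mul_assoc, Nat.cast_add, Nat.cast_one, h3]
    congr 2
    rcases Nat.even_or_odd N with hN | hN
    · rw [hN.neg_one_pow, (show Even (N + 1 + 1) from hN.add_one.add_one).neg_one_pow,
        (show Even (N + 1 + 1) from hN.add_one.add_one).neg_one_pow, zpow_one, one_mul, one_mul,
        Complex.exp_sub, Complex.exp_log h1, Complex.exp_log h2]
      push_cast
      rw [show -w * (1 / ((N : ℂ) + 1)) = -w / (N + 1) by ring]
      field_simp
    · rw [hN.neg_one_pow, (show Odd (N + 1 + 1) from hN.add_one.add_one).neg_one_pow,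
        (show Odd (N + 1 + 1) from hN.add_one.add_one).neg_one_pow, zpow_neg_one, neg_one_mul,
        neg_one_mul, sub_neg_eq_add, Complex.exp_add, Complex.exp_neg, Complex.exp_log h1,
        Complex.exp_log h2]
      push_cast
      rw [show -w * (-1 / ((N : ℂ) + 1)) = -(-w / (N + 1)) by ring, Complex.exp_neg]
      field_simp

theorem exp_lim_altLog {w L : ℂ} (hw : ∀ k : ℕ, w ≠ -(k : ℂ))
    (hL : Tendsto (fun N : ℕ => altLog w N + (-1) ^ N * (Real.log N / 2)) atTop (𝓝 L)) :
    Complex.exp L = Real.sqrt (Real.pi / 2) / gammaTilde w := by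
  obtain ⟨L₁, hL₁⟩ := exists_tendsto_altLog 1
  have hw0 : w ≠ 0 := by simpa using hw 0
  have hlog : Tendsto (fun N : ℕ => (-1 : ℂ) ^ N * ((Complex.log ((N : ℂ) + 1) - Real.log N) / 2))
      atTop (𝓝 0) := by
    have := (tendsto_log_add_sub_log 1).div_const 2
    rw [zero_div, tendsto_zero_iff_norm_tendsto_zero] at this
    rw [tendsto_zero_iff_norm_tendsto_zero]
    simpa using this
  have hsum : Tendsto (fun N : ℕ => altLog w (N + 1) + altLog 1 N) atTop (𝓝 (L + L₁)) := by
    have := ((hL.comp (tendsto_add_atTop_nat 1)).add hL₁).add hlog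
    rw [add_zero] at this
    refine this.congr fun N => ?_
    simp only [Function.comp_apply]
    rw [Complex.ofReal_log (by positivity : (0 : ℝ) ≤ (N + 1 : ℕ)), pow_succ]
    push_cast
    ring
  have hS := ((Complex.continuous_ofReal.tendsto _).comp tendsto_altHarmonic).const_mul (-w)
  have hlim := (hS.cexp.const_mul w).div hsum.cexp (Complex.exp_ne_zero _)
  have hΓ : gammaTilde w = w⁻¹ * Complex.exp ((gammaTilde0 : ℂ) * w) *
      (w * Complex.exp (-w * gammaTilde0) / Complex.exp (L + L₁)) := by
    rw [gammaTilde]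
    congr 1
    refine Tendsto.limUnder_eq (hlim.congr fun N => ?_)
    rw [Pi.div_apply, div_eq_iff (Complex.exp_ne_zero _)]
    exact (prod_mul_exp_altLog hw N).symm
  rw [hΓ, ← exp_neg_lim_altLog_one hL₁, neg_mul, Complex.exp_neg, Complex.exp_neg, mul_comm w,
    Complex.exp_add]
  field_simp

end gammaTilde

/-- Mizuno-type result: the alternating series
`Λ*(s) = ∑_{m=0}^∞ (−1)^{m+1} ∏_{j=1}^n (m+z_j)^{−s}` converges for `Re(s) > 0`,
has an analytic continuation `F` to `{Re(s) > −1/n}`, and for any such continuation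
`exp(F′(0)) = (√(π/2))^n / ∏_j Γ̃(z_j)`. -/
theorem mizuno_type (n : ℕ) (hn : 1 ≤ n) (z : Fin n → ℂ)
    (hz : ∀ j, ∀ k : ℕ, z j ≠ -(k : ℂ)) :
    (∀ s : ℂ, 0 < s.re → ∃ L : ℂ,
      Tendsto (fun N : ℕ => ∑ m ∈ Finset.range N,
        (-1 : ℂ) ^ (m + 1) * ∏ j, ((m : ℂ) + z j) ^ (-s)) atTop (𝓝 L)) ∧
    (∃ F : ℂ → ℂ, AnalyticOnNhd ℂ F {s : ℂ | -(1 / (n : ℝ)) < s.re} ∧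
      ∀ s : ℂ, 0 < s.re →
        Tendsto (fun N : ℕ => ∑ m ∈ Finset.range N,
          (-1 : ℂ) ^ (m + 1) * ∏ j, ((m : ℂ) + z j) ^ (-s)) atTop (𝓝 (F s))) ∧
    (∀ F : ℂ → ℂ, AnalyticOnNhd ℂ F {s : ℂ | -(1 / (n : ℝ)) < s.re} →
      (∀ s : ℂ, 0 < s.re →
        Tendsto (fun N : ℕ => ∑ m ∈ Finset.range N,
          (-1 : ℂ) ^ (m + 1) * ∏ j, ((m : ℂ) + z j) ^ (-s)) atTop (𝓝 (F s))) →
      Complex.exp (deriv F 0) =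
        ((Real.sqrt (Real.pi / 2) : ℂ)) ^ n / ∏ j, gammaTilde (z j)) := by
  have : Nonempty (Fin n) := ⟨⟨0, hn⟩⟩
  have hcard : (Fintype.card (Fin n) : ℝ) = n := by simp
  have hterm : ∀ (s : ℂ) (N : ℕ), ∑ m ∈ range N, (-1 : ℂ) ^ (m + 1) * ∏ j, ((m : ℂ) + z j) ^ (-s) =
      ∑ m ∈ range N, (-1 : ℂ) ^ (m + 1) * prodPow z s m := fun s N =>
    Finset.sum_congr rfl fun m _ => by
      rw [← prod_cpow_eq_prodPow s fun j h => hz j m ?_]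
      · simp
      · simpa using eq_neg_of_add_eq_zero_right h
  simp only [hterm, ← hcard]
  refine ⟨fun s hs => ⟨_, tendsto_sum_altZeta z hs⟩,
    ⟨altZeta z, analyticOnNhd_altZeta z, fun s hs => tendsto_sum_altZeta z hs⟩,
    fun F hF hFlim => ?_⟩
  have hU : -(1 / (Fintype.card (Fin n) : ℝ)) < 0 := by
    rw [hcard, neg_lt_zero]
    have : (0 : ℝ) < n := by exact_mod_cast hn
    positivity
  have hopen : IsOpen {s : ℂ | 0 < s.re} := isOpen_lt continuous_const Complex.continuous_re
  have heq : Set.EqOn F (altZeta z) {s : ℂ | -(1 / (Fintype.card (Fin n) : ℝ)) < s.re} := by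
    refine hF.eqOn_of_preconnected_of_eventuallyEq (analyticOnNhd_altZeta z)
      (convex_halfSpace_re_gt _).isPreconnected (z₀ := 1) (hU.trans (by simp)) ?_
    filter_upwards [hopen.mem_nhds (show (1 : ℂ) ∈ {s : ℂ | 0 < s.re} by simp)] with s hs
    exact tendsto_nhds_unique (hFlim s hs) (tendsto_sum_altZeta z hs)
  have hderiv : deriv F 0 = deriv (altZeta z) 0 := by
    refine Filter.EventuallyEq.deriv_eq ?_
    filter_upwards [(isOpen_lt continuous_const Complex.continuous_re).mem_nhds
      (show (0 : ℂ) ∈ {s : ℂ | -(1 / (Fintype.card (Fin n) : ℝ)) < s.re} from hU)]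
      with s hs using heq hs
  choose L hL using fun j => exists_tendsto_altLog (z j)
  have hsum : deriv (altZeta z) 0 = ∑ j, L j := by
    refine tendsto_nhds_unique (tendsto_deriv_altZeta z)
      ((tendsto_finsetSum _ fun j _ => hL j).congr fun N => ?_)
    simp only [altLog, logSum, Finset.sum_add_distrib, Finset.mul_sum, Finset.sum_const,
      Finset.card_univ, nsmul_eq_mul, Complex.ofReal_natCast]
    rw [Finset.sum_comm]
    ring
  rw [hderiv, hsum, Complex.exp_sum,
    Finset.prod_congr rfl fun j _ => exp_lim_altLog (hz j) (hL j), Finset.prod_div_distrib,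
    Finset.prod_const, Finset.card_univ, Fintype.card_fin]
end

section
/- Lerch-type formula: let x be a complex number that is not a nonpositive integer. The series Λ*(s) = ∑_{m=0}^∞ (−1)^{m+1} (m+x)^{−s} converges for Re(s) > 0 and admits an analytic continuation F to the half-plane {s ∈ ℂ : Re(s) > −1}, and for any such analytic continuation F one has exp(F′(0)) = √(π/2) / Γ̃(x). (This is the zeta-regularized identity ∏_{m=0}^∞ (m+x)^{(−1)^m} = √(π/2) / Γ̃(x).) -/
open Filter Finset Topology

lemma tendsto_of_tendsto_two_mul_of_tendsto_two_mul_add_one {α : Type*} {l : Filter α}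
    {u : ℕ → α} (he : Tendsto (fun n => u (2 * n)) atTop l)
    (ho : Tendsto (fun n => u (2 * n + 1)) atTop l) : Tendsto u atTop l := by
  intro s hs
  obtain ⟨a, ha⟩ := mem_atTop_sets.1 (he hs)
  obtain ⟨b, hb⟩ := mem_atTop_sets.1 (ho hs)
  refine mem_atTop_sets.2 ⟨2 * a + 2 * b, fun n hn => ?_⟩
  rcases Nat.even_or_odd' n with ⟨k, rfl | rfl⟩
  · exact ha k (by lia)
  · exact hb k (by lia)

lemma norm_cpow_le_of_le_re {z c : ℂ} {r : ℝ} (hr : 0 < r) (hz : r ≤ z.re) (hc : c.re ≤ 0) :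
    ‖z ^ c‖ ≤ r ^ c.re * Real.exp (Real.pi * ‖c‖) := by
  have hz0 : z ≠ 0 := by
    rintro rfl
    simp only [Complex.zero_re] at hz
    linarith
  have hrz : r ≤ ‖z‖ := hz.trans (Complex.re_le_norm z)
  rw [Complex.norm_cpow_of_ne_zero hz0, div_eq_mul_inv, ← Real.exp_neg]
  refine mul_le_mul (Real.rpow_le_rpow_of_nonpos hr hrz hc) (Real.exp_le_exp.2 ?_)
    (Real.exp_pos _).le (Real.rpow_nonneg hr.le _)
  calc -(z.arg * c.im) ≤ |z.arg * c.im| := neg_le_abs _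
    _ = |z.arg| * |c.im| := abs_mul _ _
    _ ≤ Real.pi * ‖c‖ := mul_le_mul (Complex.abs_arg_le_pi z) (Complex.abs_im_le_norm c)
        (abs_nonneg _) Real.pi_pos.le

lemma norm_second_difference_cpow_le {z c : ℂ} {r : ℝ} (hr : 0 < r) (hz : r ≤ z.re)
    (hc : c.re ≤ 2) :
    ‖z ^ c - 2 * (z + 1) ^ c + (z + 2) ^ c‖ ≤
      ‖c‖ * ‖c - 1‖ * (r ^ (c.re - 2) * Real.exp (Real.pi * ‖c - 2‖)) := by
  set C := ‖c‖ * ‖c - 1‖ * (r ^ (c.re - 2) * Real.exp (Real.pi * ‖c - 2‖)) with hC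
  let S : Set ℂ := {w | r ≤ w.re}
  have hS : Convex ℝ S := convex_halfSpace_re_ge r
  have hslit : ∀ w ∈ S, w ∈ Complex.slitPlane := fun w hw => Or.inl (hr.trans_le hw)
  have hadd : ∀ w ∈ S, w + 1 ∈ S := fun w hw => by
    have : r ≤ w.re := hw
    change r ≤ (w + 1).re
    simp only [Complex.add_re, Complex.one_re]
    linarith
  have hderiv (e : ℂ) : ∀ w ∈ S, HasDerivAt (fun w : ℂ => w ^ e) (e * w ^ (e - 1)) w :=
    fun w hw => by simpa using (hasDerivAt_id w).cpow_const (c := e) (hslit w hw)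
  have hfst : ∀ w ∈ S, ‖c * (w + 1) ^ (c - 1) - c * w ^ (c - 1)‖ ≤ C := fun w hw => by
    have := hS.norm_image_sub_le_of_norm_hasDerivWithin_le
      (f := fun w : ℂ => c * w ^ (c - 1)) (C := C)
      (fun v hv => ((hderiv (c - 1) v hv).const_mul c).hasDerivWithinAt)
      (fun v hv => by
        rw [hC, norm_mul, norm_mul, mul_assoc, sub_sub, one_add_one_eq_two]
        gcongr
        simpa using norm_cpow_le_of_le_re (c := c - 2) hr hv (by simpa using hc)) hw (hadd w hw)
    simpa using this
  have := hS.norm_image_sub_le_of_norm_hasDerivWithin_le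
      (f := fun w : ℂ => (w + 1) ^ c - w ^ c) (C := C)
      (fun v hv => (((hderiv c (v + 1) (hadd v hv)).comp_add_const v 1).sub
        (hderiv c v hv)).hasDerivWithinAt)
      hfst (show z ∈ S from hz) (hadd z hz)
  have h2 : z + 1 + 1 = z + 2 := by ring
  simp only [h2, add_sub_cancel_left, norm_one, mul_one] at this
  calc ‖z ^ c - 2 * (z + 1) ^ c + (z + 2) ^ c‖
      = ‖(z + 2) ^ c - (z + 1) ^ c - ((z + 1) ^ c - z ^ c)‖ := by congr 1; ring
    _ ≤ C := this

/-- The partial sums `∑_{m < 2n} (-1)^{m+1} (m+x)^{-s}`, corrected by half of the next term. -/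
noncomputable def lerchAverage (x : ℂ) (n : ℕ) (s : ℂ) : ℂ :=
  ∑ m ∈ Finset.range (2 * n), (-1 : ℂ) ^ (m + 1) * ((m : ℂ) + x) ^ (-s)
    - 1 / 2 * (((2 * n : ℕ) : ℂ) + x) ^ (-s)

lemma lerchAverage_succ_sub (x : ℂ) (n : ℕ) (s : ℂ) :
    lerchAverage x (n + 1) s - lerchAverage x n s = -(1 / 2) *
      ((((2 * n : ℕ) : ℂ) + x) ^ (-s) - 2 * (((2 * n : ℕ) : ℂ) + x + 1) ^ (-s)
        + (((2 * n : ℕ) : ℂ) + x + 2) ^ (-s)) := by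
  have h1 : ((2 * n + 1 : ℕ) : ℂ) + x = ((2 * n : ℕ) : ℂ) + x + 1 := by push_cast; ring
  have h2 : ((2 * n + 2 : ℕ) : ℂ) + x = ((2 * n : ℕ) : ℂ) + x + 2 := by push_cast; ring
  simp only [lerchAverage, Nat.mul_succ, sum_range_succ, h1, h2]
  rw [show (-1 : ℂ) ^ (2 * n + 1) = -1 from Odd.neg_one_pow ⟨n, rfl⟩,
    show (-1 : ℂ) ^ (2 * n + 1 + 1) = 1 from Even.neg_one_pow ⟨n + 1, by ring⟩]
  ring

lemma hasDerivAt_lerchAverage {x : ℂ} (hx : ∀ k : ℕ, x ≠ -(k : ℂ)) (n : ℕ) (s : ℂ) :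
    HasDerivAt (lerchAverage x n)
      (∑ m ∈ Finset.range (2 * n), (-1 : ℂ) ^ m * (((m : ℂ) + x) ^ (-s) * Complex.log (m + x))
        + 1 / 2 * ((((2 * n : ℕ) : ℂ) + x) ^ (-s) * Complex.log ((2 * n : ℕ) + x))) s := by
  have h (m : ℕ) : HasDerivAt (fun s : ℂ => ((m : ℂ) + x) ^ (-s))
      (-(((m : ℂ) + x) ^ (-s) * Complex.log (m + x))) s := by
    have hm : (m : ℂ) + x ≠ 0 := fun h => hx m (by linear_combination h)
    simpa using (hasDerivAt_id s).neg.const_cpow (Or.inl hm)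
  have := (HasDerivAt.fun_sum (u := Finset.range (2 * n)) fun m _ =>
    (h m).const_mul ((-1 : ℂ) ^ (m + 1))).sub ((h (2 * n)).const_mul (1 / 2))
  refine this.congr_deriv ?_
  rw [mul_neg, sub_neg_eq_add]
  congr 1
  refine sum_congr rfl fun m _ => ?_
  ring

lemma tendstoUniformlyOn_lerchAverage (x : ℂ) {K : Set ℂ} (hK : IsCompact K)
    (hKU : K ⊆ {s : ℂ | (-1 : ℝ) < s.re}) :
    TendstoUniformlyOn (lerchAverage x)
      (fun s => lerchAverage x 0 s + ∑' n, (lerchAverage x (n + 1) s - lerchAverage x n s))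
      atTop K := by
  rcases K.eq_empty_or_nonempty with rfl | hne
  · exact tendstoUniformlyOn_empty
  obtain ⟨s₀, hs₀, hmin⟩ := hK.exists_isMinOn hne Complex.continuous_re.continuousOn
  obtain ⟨R, hR⟩ := hK.isBounded.exists_norm_le
  have hσ : -1 < s₀.re := hKU hs₀
  have hR0 : 0 ≤ R := (norm_nonneg _).trans (hR _ hs₀)
  let u : ℕ → ℝ := fun n =>
    R * (R + 1) * (((n + 1 : ℕ) : ℝ) ^ (-s₀.re - 2) * Real.exp (Real.pi * (R + 2)))
  have hu : Summable u := by
    refine Summable.mul_left _ (Summable.mul_right _ ?_)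
    exact (summable_nat_add_iff 1).2 (Real.summable_nat_rpow.2 (by linarith))
  have hbound : ∀ᶠ n : ℕ in atTop, ∀ s ∈ K,
      ‖lerchAverage x (n + 1) s - lerchAverage x n s‖ ≤ u n := by
    filter_upwards [eventually_ge_atTop ⌈1 - x.re⌉₊] with n hn s hs
    have hn' : 1 - x.re ≤ n := (Nat.le_ceil _).trans (by exact_mod_cast hn)
    have hre : s₀.re ≤ s.re := hmin hs
    have hsR := hR s hs
    have hpos : (0 : ℝ) < (n + 1 : ℕ) := by positivity
    have hone : (1 : ℝ) ≤ (n + 1 : ℕ) := by simp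
    have h := norm_second_difference_cpow_le (z := ((2 * n : ℕ) : ℂ) + x) (c := -s) hpos
      (by simp; linarith) (by simp; linarith)
    rw [lerchAverage_succ_sub, norm_mul]
    have h1 : ‖-s - 1‖ ≤ R + 1 := (norm_sub_le _ _).trans (by simpa using hsR)
    have h2 : ‖-s - 2‖ ≤ R + 2 := (norm_sub_le _ _).trans (by simpa using hsR)
    refine (mul_le_of_le_one_left (norm_nonneg _) (by norm_num)).trans (h.trans ?_)
    simp only [u, norm_neg, Complex.neg_re]
    gcongr
  have := tendstoUniformlyOn_tsum_nat_eventually hu hbound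
  rw [Metric.tendstoUniformlyOn_iff] at this ⊢
  intro ε hε
  filter_upwards [this ε hε] with n hn s hs
  have h := hn s hs
  rw [sum_range_sub (fun n => lerchAverage x n s)] at h
  rw [dist_eq_norm] at h ⊢
  convert h using 2
  ring

/-- The analytic continuation of `∑ (-1)^{m+1} (m+x)^{-s}` to the half-plane `-1 < re s`. -/
noncomputable def lerchContinuation (x s : ℂ) : ℂ :=
  lerchAverage x 0 s + ∑' n, (lerchAverage x (n + 1) s - lerchAverage x n s)

lemma isOpen_neg_one_lt_re : IsOpen {s : ℂ | (-1 : ℝ) < s.re} :=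
  isOpen_lt continuous_const Complex.continuous_re

lemma tendstoLocallyUniformlyOn_lerchAverage (x : ℂ) :
    TendstoLocallyUniformlyOn (lerchAverage x) (lerchContinuation x) atTop
      {s : ℂ | (-1 : ℝ) < s.re} :=
  (tendstoLocallyUniformlyOn_iff_forall_isCompact isOpen_neg_one_lt_re).2
    fun _ hKU hK => tendstoUniformlyOn_lerchAverage x hK hKU

lemma differentiableOn_lerchAverage {x : ℂ} (hx : ∀ k : ℕ, x ≠ -(k : ℂ)) (n : ℕ) (U : Set ℂ) :
    DifferentiableOn ℂ (lerchAverage x n) U :=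
  fun s _ => (hasDerivAt_lerchAverage hx n s).differentiableAt.differentiableWithinAt

lemma analyticOnNhd_lerchContinuation {x : ℂ} (hx : ∀ k : ℕ, x ≠ -(k : ℂ)) :
    AnalyticOnNhd ℂ (lerchContinuation x) {s : ℂ | (-1 : ℝ) < s.re} :=
  ((tendstoLocallyUniformlyOn_lerchAverage x).differentiableOn
    (.of_forall fun n => differentiableOn_lerchAverage hx n _)
    isOpen_neg_one_lt_re).analyticOnNhd isOpen_neg_one_lt_re

lemma tendsto_natCast_add_cpow_neg (x : ℂ) {s : ℂ} (hs : 0 < s.re) :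
    Tendsto (fun n : ℕ => ((n : ℂ) + x) ^ (-s)) atTop (𝓝 0) := by
  have h : Tendsto (fun n : ℕ => ((n : ℝ) + x.re) ^ (-s.re) * Real.exp (Real.pi * ‖s‖))
      atTop (𝓝 0) := by
    simpa using ((tendsto_rpow_neg_atTop hs).comp
      (tendsto_atTop_add_const_right _ x.re tendsto_natCast_atTop_atTop)).mul_const
        (Real.exp (Real.pi * ‖s‖))
  refine squeeze_zero_norm' ?_ h
  filter_upwards [eventually_gt_atTop ⌈-x.re⌉₊] with n hn
  have hn' : -x.re < n := (Nat.le_ceil _).trans_lt (by exact_mod_cast hn)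
  simpa using norm_cpow_le_of_le_re (z := (n : ℂ) + x) (c := -s) (r := n + x.re)
    (by linarith) (by simp) (by simpa using hs.le)

lemma tendsto_lerchContinuation (x : ℂ) {s : ℂ} (hs : 0 < s.re) :
    Tendsto (fun N : ℕ => ∑ m ∈ Finset.range N, (-1 : ℂ) ^ (m + 1) * ((m : ℂ) + x) ^ (-s))
      atTop (𝓝 (lerchContinuation x s)) := by
  have h2 : Tendsto (fun n : ℕ => 2 * n) atTop atTop := tendsto_id.const_mul_atTop' two_pos
  have hterm := (tendsto_natCast_add_cpow_neg x hs).comp h2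
  have heven : Tendsto (fun n : ℕ =>
      ∑ m ∈ Finset.range (2 * n), (-1 : ℂ) ^ (m + 1) * ((m : ℂ) + x) ^ (-s))
      atTop (𝓝 (lerchContinuation x s)) := by
    have hmem : s ∈ {s : ℂ | (-1 : ℝ) < s.re} := show (-1 : ℝ) < s.re by linarith
    have := ((tendstoLocallyUniformlyOn_lerchAverage x).tendsto_at hmem).add
      (hterm.const_mul (1 / 2))
    simpa [lerchAverage] using this
  refine tendsto_of_tendsto_two_mul_of_tendsto_two_mul_add_one heven ?_
  have := heven.sub hterm
  rw [sub_zero] at this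
  refine this.congr fun n => ?_
  rw [sum_range_succ, Odd.neg_one_pow ⟨n, rfl⟩, neg_one_mul, ← sub_eq_add_neg,
    Function.comp_apply]

lemma tendsto_deriv_lerchContinuation_zero {x : ℂ} (hx : ∀ k : ℕ, x ≠ -(k : ℂ)) :
    Tendsto (fun n : ℕ => ∑ m ∈ Finset.range (2 * n), (-1 : ℂ) ^ m * Complex.log (m + x)
      + 1 / 2 * Complex.log ((2 * n : ℕ) + x)) atTop (𝓝 (deriv (lerchContinuation x) 0)) := by
  have := ((tendstoLocallyUniformlyOn_lerchAverage x).deriv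
    (.of_forall fun n => differentiableOn_lerchAverage hx n _) isOpen_neg_one_lt_re).tendsto_at
    (show (0 : ℂ) ∈ {s : ℂ | (-1 : ℝ) < s.re} by simp)
  refine this.congr fun n => ?_
  simpa using (hasDerivAt_lerchAverage hx n 0).deriv

lemma eqOn_lerchContinuation {x : ℂ} (hx : ∀ k : ℕ, x ≠ -(k : ℂ)) {F : ℂ → ℂ}
    (hF : AnalyticOnNhd ℂ F {s : ℂ | (-1 : ℝ) < s.re})
    (hlim : ∀ s : ℂ, 0 < s.re →
      Tendsto (fun N : ℕ => ∑ m ∈ Finset.range N,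
        (-1 : ℂ) ^ (m + 1) * ((m : ℂ) + x) ^ (-s)) atTop (𝓝 (F s))) :
    Set.EqOn F (lerchContinuation x) {s : ℂ | (-1 : ℝ) < s.re} := by
  refine hF.eqOn_of_preconnected_of_eventuallyEq (analyticOnNhd_lerchContinuation hx)
    (convex_halfSpace_re_gt (-1)).isPreconnected (z₀ := 1) (by simp) ?_
  filter_upwards [(isOpen_lt continuous_const Complex.continuous_re).mem_nhds
    (show (1 : ℂ) ∈ {s : ℂ | (0 : ℝ) < s.re} by simp)] with s hs
  exact tendsto_nhds_unique (hlim s hs) (tendsto_lerchContinuation x hs)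

lemma tendsto_alternating_harmonic_gammaTilde0 :
    Tendsto (fun n : ℕ => ∑ j ∈ Finset.range n, (-1 : ℝ) ^ j / (j + 1)) atTop
      (𝓝 gammaTilde0) := by
  have hsum : Summable fun j : ℕ => (-1 : ℝ) ^ j / ((j + 1) * (j + 2)) := by
    refine Summable.of_norm_bounded
      ((summable_nat_add_iff 1).2 (Real.summable_one_div_nat_pow.2 one_lt_two)) fun j => ?_
    rw [norm_div, norm_pow, norm_neg, norm_one, one_pow, Real.norm_of_nonneg (by positivity)]
    push_cast
    rw [sq]
    gcongr
    norm_num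
  have hzero : Tendsto (fun n : ℕ => (1 : ℝ) / 2 * ((-1) ^ n / (n + 1))) atTop (𝓝 0) := by
    refine squeeze_zero_norm (fun n => ?_) tendsto_one_div_add_atTop_nhds_zero_nat
    rw [norm_mul, norm_div ((-1 : ℝ) ^ n), norm_pow, norm_neg, norm_one, one_pow,
      Real.norm_of_nonneg (by positivity : (0 : ℝ) ≤ n + 1)]
    exact mul_le_of_le_one_left (by positivity) (by norm_num)
  have hid (n : ℕ) : ∑ j ∈ Finset.range n, (-1 : ℝ) ^ j / (j + 1) =
      1 / 2 + 1 / 2 * ∑ j ∈ Finset.range n, (-1 : ℝ) ^ j / ((j + 1) * (j + 2))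
        - 1 / 2 * ((-1) ^ n / (n + 1)) := by
    induction n with
    | zero => norm_num
    | succ n ih =>
      rw [sum_range_succ, sum_range_succ, ih]
      push_cast
      field_simp
      ring
  have := ((hsum.hasSum.tendsto_sum_nat.const_mul (1 / 2)).const_add (1 / 2)).sub hzero
  rw [sub_zero] at this
  exact this.congr fun n => (hid n).symm

lemma exp_alternating_sum_log {x : ℂ} (hx : ∀ k : ℕ, x ≠ -(k : ℂ)) (N : ℕ) :
    Complex.exp (∑ m ∈ Finset.range N, (-1 : ℂ) ^ m * Complex.log (m + x)) =
      ∏ m ∈ Finset.range N, ((m : ℂ) + x) ^ ((-1 : ℤ) ^ m) := by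
  rw [Complex.exp_sum]
  refine prod_congr rfl fun m _ => ?_
  have hm : (m : ℂ) + x ≠ 0 := fun h => hx m (by linear_combination h)
  rcases Nat.even_or_odd m with h | h
  · simp [h.neg_one_pow, Complex.exp_log hm]
  · simp [h.neg_one_pow, Complex.exp_neg, Complex.exp_log hm]

lemma sq_alternating_prod_mul_wallis (n : ℕ) :
    (∏ j ∈ Finset.range (2 * n + 1), ((j : ℝ) + 1) ^ ((-1 : ℤ) ^ j)) ^ 2 * Real.Wallis.W n =
      2 * n + 1 := by
  induction n with
  | zero => simp [Real.Wallis.W]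
  | succ n ih =>
    rw [show 2 * (n + 1) + 1 = 2 * n + 1 + 1 + 1 by ring, prod_range_succ, prod_range_succ,
      Real.Wallis.W_succ, Odd.neg_one_pow ⟨n, rfl⟩,
      Even.neg_one_pow (n := 2 * n + 1 + 1) ⟨n + 1, by ring⟩, zpow_one, zpow_neg_one, mul_pow,
      mul_pow]
    set Q := (∏ j ∈ Finset.range (2 * n + 1), ((j : ℝ) + 1) ^ ((-1 : ℤ) ^ j)) ^ 2
    push_cast
    have : Q * Real.Wallis.W n / (2 * n + 1) = 1 := by
      rw [ih]
      exact div_self (by positivity)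
    calc _ = Q * Real.Wallis.W n / (2 * n + 1) * (2 * n + 3) := by
          field_simp
          ring
      _ = _ := by rw [this]; ring

lemma tendsto_sqrt_div_alternating_prod :
    Tendsto (fun n : ℕ => √(2 * n + 2) /
        ∏ j ∈ Finset.range (2 * n + 1), ((j : ℝ) + 1) ^ ((-1 : ℤ) ^ j)) atTop
      (𝓝 √(Real.pi / 2)) := by
  have h1 : Tendsto (fun n : ℕ => (1 + 1 / (2 * (n : ℝ) + 1)) * Real.Wallis.W n) atTop
      (𝓝 (Real.pi / 2)) := by
    have hinv : Tendsto (fun n : ℕ => 1 / (2 * (n : ℝ) + 1)) atTop (𝓝 0) := by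
      refine squeeze_zero (fun n => by positivity) (fun n => ?_)
        tendsto_one_div_add_atTop_nhds_zero_nat
      gcongr
      linarith [n.cast_nonneg (α := ℝ)]
    simpa using (hinv.const_add 1).mul Real.Wallis.tendsto_W_nhds_pi_div_two
  refine h1.sqrt.congr fun n => ?_
  have hQ : 0 < ∏ j ∈ Finset.range (2 * n + 1), ((j : ℝ) + 1) ^ ((-1 : ℤ) ^ j) :=
    prod_pos fun j _ => by positivity
  have h := sq_alternating_prod_mul_wallis n
  set Q := ∏ j ∈ Finset.range (2 * n + 1), ((j : ℝ) + 1) ^ ((-1 : ℤ) ^ j)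
  rw [Real.sqrt_eq_iff_mul_self_eq_of_pos (by positivity), ← sq, div_pow,
    Real.sq_sqrt (by positivity), div_eq_iff (by positivity)]
  have : (1 + 1 / (2 * (n : ℝ) + 1)) * (2 * n + 1) = 2 * n + 2 := by
    field_simp
    ring
  linear_combination -(1 + 1 / (2 * (n : ℝ) + 1)) * h - this

lemma prod_Icc_gammaTilde_factor {x : ℂ} (hx : ∀ k : ℕ, x ≠ -(k : ℂ)) (N : ℕ) :
    ∏ m ∈ Finset.Icc 1 N,
        (Complex.exp (-x / (m : ℂ)) * (1 + x / (m : ℂ))) ^ ((-1 : ℤ) ^ (m + 1)) =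
      Complex.exp (-x * ∑ j ∈ Finset.range N, (-1 : ℂ) ^ j / (j + 1)) * x /
        ((∏ m ∈ Finset.range (N + 1), ((m : ℂ) + x) ^ ((-1 : ℤ) ^ m)) *
          ∏ j ∈ Finset.range N, ((j : ℂ) + 1) ^ ((-1 : ℤ) ^ j)) := by
  have hm (m : ℕ) : (m : ℂ) + x ≠ 0 := fun h => hx m (by linear_combination h)
  induction N with
  | zero =>
    have : x ≠ 0 := by simpa using hx 0
    simp [this]
  | succ N ih =>
    have hN : (N : ℂ) + 1 ≠ 0 := N.cast_add_one_ne_zero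
    have hNx : (N : ℂ) + 1 + x ≠ 0 := by exact_mod_cast hm (N + 1)
    have hP : ∏ m ∈ Finset.range (N + 1), ((m : ℂ) + x) ^ ((-1 : ℤ) ^ m) ≠ 0 :=
      prod_ne_zero_iff.2 fun m _ => zpow_ne_zero _ (hm m)
    have hQ : ∏ j ∈ Finset.range N, ((j : ℂ) + 1) ^ ((-1 : ℤ) ^ j) ≠ 0 :=
      prod_ne_zero_iff.2 fun j _ => zpow_ne_zero _ j.cast_add_one_ne_zero
    rw [prod_Icc_succ_top (by lia), ih,
      prod_range_succ (fun m : ℕ => ((m : ℂ) + x) ^ ((-1 : ℤ) ^ m)) (N + 1),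
      prod_range_succ (fun j : ℕ => ((j : ℂ) + 1) ^ ((-1 : ℤ) ^ j)) N, sum_range_succ,
      mul_add (-x), Complex.exp_add, pow_succ _ (N + 1), pow_succ _ N]
    push_cast
    have hfac : 1 + x / ((N : ℂ) + 1) = ((N : ℂ) + 1 + x) / (N + 1) := by field_simp
    rcases Nat.even_or_odd N with h | h
    · rw [h.neg_one_pow, h.neg_one_pow, hfac, mul_one_div]
      simp
      field_simp
    · have hneg : -x * (-1 / ((N : ℂ) + 1)) = -(-x / (N + 1)) := by ring
      rw [h.neg_one_pow, h.neg_one_pow, hfac, hneg, Complex.exp_neg]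
      simp
      field_simp

lemma tendsto_prod_gammaTilde_factor {x : ℂ} (hx : ∀ k : ℕ, x ≠ -(k : ℂ)) :
    Tendsto (fun N : ℕ => ∏ m ∈ Finset.Icc 1 N,
        (Complex.exp (-x / (m : ℂ)) * (1 + x / (m : ℂ))) ^ ((-1 : ℤ) ^ (m + 1))) atTop
      (𝓝 (Complex.exp (-x * gammaTilde0) * x *
        ((√(Real.pi / 2) : ℂ) / Complex.exp (deriv (lerchContinuation x) 0)))) := by
  have hdiv : Tendsto (fun n : ℕ => x / (n : ℂ)) atTop (𝓝 0) :=
    tendsto_const_div_atTop_nhds_zero_nat x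
  have hsucc : Tendsto (fun n : ℕ => 2 * n + 2) atTop atTop :=
    tendsto_atTop_mono (fun n => show n ≤ _ by lia) tendsto_id
  have hodd : Tendsto (fun n : ℕ => 2 * n + 1) atTop atTop :=
    tendsto_atTop_mono (fun n => show n ≤ _ by lia) tendsto_id
  have hdiv2 : Tendsto (fun n : ℕ => x / ((2 * n + 2 : ℕ) : ℂ)) atTop (𝓝 0) := hdiv.comp hsucc
  have hH : Tendsto (fun n : ℕ =>
      Complex.exp (-x * ∑ j ∈ Finset.range (2 * n + 1), (-1 : ℂ) ^ j / (j + 1))) atTop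
      (𝓝 (Complex.exp (-x * gammaTilde0))) := by
    have := (Complex.continuous_ofReal.tendsto _).comp
      (tendsto_alternating_harmonic_gammaTilde0.comp hodd)
    refine (Complex.continuous_exp.tendsto _).comp (Tendsto.const_mul (-x) ?_)
    simpa [Function.comp_def] using this
  have hW : Tendsto (fun n : ℕ => ((√(2 * n + 2) : ℝ) : ℂ) /
      ∏ j ∈ Finset.range (2 * n + 1), ((j : ℂ) + 1) ^ ((-1 : ℤ) ^ j)) atTop
      (𝓝 (√(Real.pi / 2) : ℂ)) := by
    have := (Complex.continuous_ofReal.tendsto _).comp tendsto_sqrt_div_alternating_prod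
    simpa [Function.comp_def] using this
  have hE := (Complex.continuous_exp.tendsto _).comp
    ((tendsto_add_atTop_iff_nat 1).2 (tendsto_deriv_lerchContinuation_zero hx))
  have hL : Tendsto (fun n : ℕ =>
      Complex.exp (1 / 2 * Complex.log (1 + x / ((2 * n + 2 : ℕ) : ℂ)))) atTop (𝓝 1) := by
    have h1 : Tendsto (fun n : ℕ => 1 + x / ((2 * n + 2 : ℕ) : ℂ)) atTop (𝓝 1) := by
      simpa using hdiv2.const_add 1
    have := (Complex.continuous_exp.tendsto _).comp ((h1.clog (by simp)).const_mul (1 / 2))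
    simpa [Function.comp_def] using this
  have hodd_lim : Tendsto (fun n : ℕ => ∏ m ∈ Finset.Icc 1 (2 * n + 1),
        (Complex.exp (-x / (m : ℂ)) * (1 + x / (m : ℂ))) ^ ((-1 : ℤ) ^ (m + 1))) atTop
      (𝓝 (Complex.exp (-x * gammaTilde0) * x *
        ((√(Real.pi / 2) : ℂ) / Complex.exp (deriv (lerchContinuation x) 0)))) := by
    have := (hH.mul_const x).mul ((hW.mul hL).div hE (Complex.exp_ne_zero _))
    rw [mul_one] at this
    refine this.congr fun n => ?_
    have hpos : (0 : ℝ) < 2 * n + 2 := by positivity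
    have hne : (2 * n + 2 : ℂ) ≠ 0 := by exact_mod_cast hpos.ne'
    have hxn : (2 * n + 2 : ℂ) + x ≠ 0 := fun h =>
      hx (2 * n + 2) (by push_cast; linear_combination h)
    have hsqrt : Complex.exp (1 / 2 * Complex.log ((2 * n + 2 : ℕ) + x)) =
        (√(2 * n + 2) : ℝ) *
          Complex.exp (1 / 2 * Complex.log (1 + x / ((2 * n + 2 : ℕ) : ℂ))) := by
      have hfac : ((2 * n + 2 : ℕ) : ℂ) + x =
          ((2 * n + 2 : ℝ) : ℂ) * (1 + x / ((2 * n + 2 : ℕ) : ℂ)) := by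
        push_cast
        field_simp
      have hne' : 1 + x / ((2 * n + 2 : ℕ) : ℂ) ≠ 0 := by
        intro h
        rw [h, mul_zero] at hfac
        exact hxn (by exact_mod_cast hfac)
      rw [hfac, Complex.log_ofReal_mul hpos hne', mul_add, Complex.exp_add,
        Real.sqrt_eq_rpow, Real.rpow_def_of_pos hpos, mul_comm (Real.log _)]
      push_cast
      rfl
    rw [prod_Icc_gammaTilde_factor hx]
    simp only [Pi.div_apply, Function.comp_apply, Complex.exp_add, exp_alternating_sum_log hx]
    rw [show 2 * (n + 1) = 2 * n + 2 by ring, hsqrt]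
    have hs : ((√(2 * n + 2) : ℝ) : ℂ) ≠ 0 := by exact_mod_cast (Real.sqrt_pos.2 hpos).ne'
    have he := Complex.exp_ne_zero (1 / 2 * Complex.log (1 + x / ((2 * n + 2 : ℕ) : ℂ)))
    generalize Complex.exp (1 / 2 * Complex.log (1 + x / ((2 * n + 2 : ℕ) : ℂ))) = e at *
    generalize ((√(2 * n + 2) : ℝ) : ℂ) = r at *
    rw [show 2 * n + 1 + 1 = 2 * n + 2 by ring]
    field_simp
  refine tendsto_of_tendsto_two_mul_of_tendsto_two_mul_add_one ?_ hodd_lim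
  refine (tendsto_add_atTop_iff_nat 1).1 ?_
  have hfactor : Tendsto (fun n : ℕ => (Complex.exp (-x / ((2 * n + 2 : ℕ) : ℂ)) *
      (1 + x / ((2 * n + 2 : ℕ) : ℂ)))⁻¹) atTop (𝓝 1) := by
    have := (((Complex.continuous_exp.tendsto _).comp hdiv2.neg).mul
      (hdiv2.const_add 1)).inv₀ (by simp)
    simpa [Function.comp_def, neg_div] using this
  have := hodd_lim.mul hfactor
  rw [mul_one] at this
  refine this.congr fun n => ?_
  rw [show 2 * (n + 1) = 2 * n + 1 + 1 by ring, prod_Icc_succ_top (b := 2 * n + 1) (by lia),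
    Odd.neg_one_pow (n := 2 * n + 1 + 1 + 1) ⟨n + 1, by ring⟩, zpow_neg_one]

lemma gammaTilde_eq {x : ℂ} (hx : ∀ k : ℕ, x ≠ -(k : ℂ)) :
    gammaTilde x =
      (√(Real.pi / 2) : ℂ) / Complex.exp (deriv (lerchContinuation x) 0) := by
  have hx0 : x ≠ 0 := by simpa using hx 0
  rw [gammaTilde, (tendsto_prod_gammaTilde_factor hx).limUnder_eq, neg_mul, Complex.exp_neg,
    mul_comm x]
  have := Complex.exp_ne_zero (gammaTilde0 * x)
  field_simp

/-- Lerch-type formula: `Λ*(s) = ∑_{m=0}^∞ (−1)^{m+1}(m+x)^{−s}` converges for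
`Re(s) > 0`, extends analytically to `{Re(s) > −1}`, and for any such continuation `F`
one has `exp(F′(0)) = √(π/2) / Γ̃(x)`. -/
theorem lerch_type (x : ℂ) (hx : ∀ k : ℕ, x ≠ -(k : ℂ)) :
    (∀ s : ℂ, 0 < s.re → ∃ L : ℂ,
      Tendsto (fun N : ℕ => ∑ m ∈ Finset.range N,
        (-1 : ℂ) ^ (m + 1) * ((m : ℂ) + x) ^ (-s)) atTop (𝓝 L)) ∧
    (∃ F : ℂ → ℂ, AnalyticOnNhd ℂ F {s : ℂ | (-1 : ℝ) < s.re} ∧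
      ∀ s : ℂ, 0 < s.re →
        Tendsto (fun N : ℕ => ∑ m ∈ Finset.range N,
          (-1 : ℂ) ^ (m + 1) * ((m : ℂ) + x) ^ (-s)) atTop (𝓝 (F s))) ∧
    (∀ F : ℂ → ℂ, AnalyticOnNhd ℂ F {s : ℂ | (-1 : ℝ) < s.re} →
      (∀ s : ℂ, 0 < s.re →
        Tendsto (fun N : ℕ => ∑ m ∈ Finset.range N,
          (-1 : ℂ) ^ (m + 1) * ((m : ℂ) + x) ^ (-s)) atTop (𝓝 (F s))) →
      Complex.exp (deriv F 0) = (Real.sqrt (Real.pi / 2) : ℂ) / gammaTilde x) := by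
  refine ⟨fun s hs => ⟨_, tendsto_lerchContinuation x hs⟩,
    ⟨lerchContinuation x, analyticOnNhd_lerchContinuation hx,
      fun s hs => tendsto_lerchContinuation x hs⟩, fun F hF hlim => ?_⟩
  have hderiv : deriv F 0 = deriv (lerchContinuation x) 0 :=
    ((eqOn_lerchContinuation hx hF hlim).eventuallyEq_of_mem
      (isOpen_neg_one_lt_re.mem_nhds (by simp))).deriv_eq
  have hpi : (√(Real.pi / 2) : ℂ) ≠ 0 := by
    exact_mod_cast (Real.sqrt_pos.2 (by positivity : 0 < Real.pi / 2)).ne'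
  rw [hderiv, gammaTilde_eq hx, div_div_cancel₀ hpi]
end
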